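/- Let N_k ⇒_SH N_{k+1} be a Shallow transformation with N_k = N ∪ {Γ → E[s]_p} and N_{k+1} = N ∪ {S(x), Γ1 → E[x]_p} ∪ {Γ2 → S(s)}, and let N⊥_{k+1} be a conflicting core of N_{k+1}. Let N_S be the set of all resolvents on the S-literal of pairs of clauses from N⊥_{k+1}. If for every clause C_j ∈ N_S (1 ≤ j ≤ m) there is a substitution σ_j with C_j = (Γ → E[s]_p)σ_j, then (N⊥_{k+1} \ {C ∈ N⊥_{k+1} | C contains an S-atom}) ∪ {(Γ → E[s]_p)σ_j | 1 ≤ j ≤ m} is a conflicting core of N_k. -/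

import Mathlib

namespace FOApprox

/-- First-order terms over a countable signature of function symbols. -/
inductive Tm : Type where
  | var : ℕ → Tm
  | fn : ℕ → List Tm → Tm

/-- Atoms: a predicate symbol applied to a list of terms. -/
structure Atom : Type where
  pred : ℕ
  args : List Tm

/-- Substitutions map variables to terms. -/
abbrev Subst := ℕ → Tm

mutual
/-- Application of a substitution to a term. -/
def Tm.subst (σ : Subst) : Tm → Tm
  | .var x => σ x
  | .fn f ts => .fn f (Tm.substList σ ts)
def Tm.substList (σ : Subst) : List Tm → List Tm
  | [] => []
  | t :: ts => Tm.subst σ t :: Tm.substList σ ts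
end

def Atom.subst (σ : Subst) (A : Atom) : Atom := ⟨A.pred, Tm.substList σ A.args⟩

/-- A clause Γ → Δ: `neg` is the multiset Γ of negative atoms,
`pos` the multiset Δ of positive atoms. -/
structure Clause : Type where
  neg : Multiset Atom
  pos : Multiset Atom

def Clause.subst (σ : Subst) (C : Clause) : Clause :=
  ⟨C.neg.map (Atom.subst σ), C.pos.map (Atom.subst σ)⟩

/-- A term is ground if it is invariant under all substitutions. -/
def Tm.Ground (t : Tm) : Prop := ∀ σ : Subst, t.subst σ = t

def Clause.Ground (C : Clause) : Prop := ∀ σ : Subst, C.subst σ = C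

/-- A grounding substitution maps every variable to a ground term. -/
def Subst.Grounding (σ : Subst) : Prop := ∀ x, (σ x).Ground

/-- A Herbrand interpretation `I` (a set of ground atoms) satisfies a clause
Γ → Δ if for every grounding substitution σ, Δσ ∩ I ≠ ∅ or Γσ ⊄ I. -/
def SatClause (I : Set Atom) (C : Clause) : Prop :=
  ∀ σ : Subst, σ.Grounding →
    (∃ A ∈ C.pos, A.subst σ ∈ I) ∨ (∃ A ∈ C.neg, A.subst σ ∉ I)

def Models (I : Set Atom) (N : Set Clause) : Prop := ∀ C ∈ N, SatClause I C

def Satisfiable (N : Set Clause) : Prop := ∃ I : Set Atom, Models I N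

/-- Apply a substitution to all clauses of a set (variables are shared). -/
def SubstSet (σ : Subst) (N : Set Clause) : Set Clause := Clause.subst σ '' N

/-- A finite clause set is a conflicting core if all its simultaneous ground
instances are unsatisfiable. -/
def ConflictingCore (Nb : Set Clause) : Prop :=
  Nb.Finite ∧ ∀ τ : Subst, τ.Grounding → ¬ Satisfiable (SubstSet τ Nb)

/-- `Nb` is a conflicting core of `N`: additionally every clause of `Nb`
is an instance of a clause of `N`. -/
def ConflictingCoreOf (Nb N : Set Clause) : Prop :=
  ConflictingCore Nb ∧ ∀ C ∈ Nb, ∃ C' ∈ N, ∃ σ : Subst, C = Clause.subst σ C'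

/-- An atom occurs (positively or negatively) in a clause. -/
def AtomIn (A : Atom) (C : Clause) : Prop := A ∈ C.neg ∨ A ∈ C.pos

mutual
def Tm.fns : Tm → List ℕ
  | .var _ => []
  | .fn f ts => f :: Tm.fnsList ts
def Tm.fnsList : List Tm → List ℕ
  | [] => []
  | t :: ts => Tm.fns t ++ Tm.fnsList ts
end

mutual
def Tm.vars : Tm → List ℕ
  | .var x => [x]
  | .fn _ ts => Tm.varsList ts
def Tm.varsList : List Tm → List ℕ
  | [] => []
  | t :: ts => Tm.vars t ++ Tm.varsList ts
end

def VarInClause (x : ℕ) (C : Clause) : Prop :=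
  ∃ A, AtomIn A C ∧ ∃ t ∈ A.args, x ∈ Tm.vars t

def FnInClause (f : ℕ) (C : Clause) : Prop :=
  ∃ A, AtomIn A C ∧ ∃ t ∈ A.args, f ∈ Tm.fns t

def PredInClause (P : ℕ) (C : Clause) : Prop := ∃ A, AtomIn A C ∧ A.pred = P

def PredIn (P : ℕ) (N : Set Clause) : Prop := ∃ C ∈ N, PredInClause P C

def PredNotIn (P : ℕ) (N : Set Clause) : Prop := ∀ C ∈ N, ¬ PredInClause P C

def FnNotIn (f : ℕ) (N : Set Clause) : Prop := ∀ C ∈ N, ¬ FnInClause f C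

def VarNotInClause (x : ℕ) (C : Clause) : Prop := ¬ VarInClause x C

/-- Subterm of a term at a position. -/
def Tm.atPos : List ℕ → Tm → Option Tm
  | [], t => some t
  | _ :: _, .var _ => none
  | i :: p, .fn _ ts => (ts[i]?).bind (Tm.atPos p)

/-- Replace the subterm at a position in a term. -/
def Tm.replaceAt : List ℕ → Tm → Tm → Option Tm
  | [], _, u => some u
  | _ :: _, .var _, _ => none
  | i :: p, .fn f ts, u =>
    (ts[i]?).bind fun t => (Tm.replaceAt p t u).map fun t' => Tm.fn f (ts.set i t')

/-- Subterm of an atom at a position: the head of the position selects an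
argument, the tail a position inside that argument. A position of length 1
is a top position. -/
def Atom.atPos (A : Atom) : List ℕ → Option Tm
  | [] => none
  | i :: p => (A.args[i]?).bind (Tm.atPos p)

def Atom.replaceAt (A : Atom) : List ℕ → Tm → Option Atom
  | [], _ => none
  | i :: p, u =>
    (A.args[i]?).bind fun t =>
      (Tm.replaceAt p t u).map fun t' => ⟨A.pred, A.args.set i t'⟩

/-- A complex term is a non-variable term. -/
def Tm.Complex : Tm → Prop
  | .var _ => False
  | .fn _ _ => True

mutual
/-- Skeleton computation with a fresh-variable counter. -/
def Tm.sktAux : Tm → ℕ → Tm × ℕ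
  | .var _, n => (.var n, n + 1)
  | .fn f ts, n =>
    let r := Tm.sktAuxList ts n
    (.fn f r.1, r.2)
def Tm.sktAuxList : List Tm → ℕ → List Tm × ℕ
  | [], n => ([], n)
  | t :: ts, n =>
    let r := Tm.sktAux t n
    let r' := Tm.sktAuxList ts r.2
    (r.1 :: r'.1, r'.2)
end

/-- The term skeleton: every variable occurrence is replaced by a distinct
fresh variable. -/
def Tm.skeleton (t : Tm) : Tm := (Tm.sktAux t 0).1

/-- The projection μ_P on atoms: replaces P(t₁,…,tₙ) by T(f_P(t₁,…,tₙ)). -/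
def projAtom (P T f : ℕ) (A : Atom) : Atom :=
  if A.pred = P then ⟨T, [Tm.fn f A.args]⟩ else A

def projClause (P T f : ℕ) (C : Clause) : Clause :=
  ⟨C.neg.map (projAtom P T f), C.pos.map (projAtom P T f)⟩

def projSet (P T f : ℕ) (N : Set Clause) : Set Clause := projClause P T f '' N

/-- The reverse projection μ_P⁻¹ on Herbrand interpretations. -/
def projInvInterp (P T f : ℕ) (I : Set Atom) : Set Atom := projAtom P T f ⁻¹' I

/-- The reverse projection μ_P⁻¹ on atoms: T(f_P(t₁,…,tₙ)) is mapped back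
to P(t₁,…,tₙ), all other atoms are unchanged. -/
def unprojAtom (P T f : ℕ) (A : Atom) : Atom :=
  match A with
  | ⟨Q, [Tm.fn g ts]⟩ => if Q = T ∧ g = f then ⟨P, ts⟩ else ⟨Q, [Tm.fn g ts]⟩
  | A => A

def unprojClause (P T f : ℕ) (C : Clause) : Clause :=
  ⟨C.neg.map (unprojAtom P T f), C.pos.map (unprojAtom P T f)⟩

/-- The substitution {x ↦ x'}. -/
def singleSubst (x x' : ℕ) : Subst := fun y => if y = x then Tm.var x' else Tm.var y

/-- Monadic transformation step (T is the fixed projection predicate,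
`fp P` the projection function symbol for the predicate `P`). -/
def MOStep (T : ℕ) (fp : ℕ → ℕ) (N N' : Set Clause) : Prop :=
  ∃ (P : ℕ) (C C' : Clause) (A : Atom) (M : Multiset Atom),
    C ∈ N ∧ A.pred = P ∧ P ≠ T ∧ 2 ≤ A.args.length ∧
    ((C.neg = A ::ₘ M ∧ C'.neg = (projAtom P T (fp P) A) ::ₘ M ∧ C'.pos = C.pos) ∨
     (C.pos = A ::ₘ M ∧ C'.pos = (projAtom P T (fp P) A) ::ₘ M ∧ C'.neg = C.neg)) ∧
    N' = (N \ {C}) ∪ {C'}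

/-- Horn transformation step: replace Γ → E₁,…,Eₙ (n > 1) by Γ → Eᵢ. -/
def HOStep (N N' : Set Clause) : Prop :=
  ∃ (C : Clause) (E : Atom),
    C ∈ N ∧ E ∈ C.pos ∧ 2 ≤ Multiset.card C.pos ∧
    N' = (N \ {C}) ∪ {⟨C.neg, {E}⟩}

/-- Shallow transformation step: replace Γ₁,Γ₂ → E[s]_p (s complex, p not a
top position) by S(x), Γ₁ → E[x]_p and Γ₂ → S(s), with S, x fresh. -/
def SHStep (N N' : Set Clause) : Prop :=
  ∃ (Γ₁ Γ₂ : Multiset Atom) (E E' : Atom) (p : List ℕ) (s : Tm) (S x : ℕ),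
    (⟨Γ₁ + Γ₂, {E}⟩ : Clause) ∈ N ∧
    E.atPos p = some s ∧ Tm.Complex s ∧ 2 ≤ p.length ∧
    PredNotIn S N ∧ VarNotInClause x ⟨Γ₁ + Γ₂, {E}⟩ ∧
    E.replaceAt p (Tm.var x) = some E' ∧
    N' = (N \ {(⟨Γ₁ + Γ₂, {E}⟩ : Clause)}) ∪
      {(⟨(⟨S, [Tm.var x]⟩ : Atom) ::ₘ Γ₁, {E'}⟩ : Clause),
       (⟨Γ₂, {(⟨S, [s]⟩ : Atom)}⟩ : Clause)}

/-- Linear transformation step: replace Γ → E[x]_{p,q} by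
Γ{x ↦ x'}, Γ → E[x']_q with x' fresh. -/
def LIStep (N N' : Set Clause) : Prop :=
  ∃ (Γ : Multiset Atom) (E E' : Atom) (p q : List ℕ) (x x' : ℕ),
    (⟨Γ, {E}⟩ : Clause) ∈ N ∧ p ≠ q ∧
    E.atPos p = some (Tm.var x) ∧ E.atPos q = some (Tm.var x) ∧
    VarNotInClause x' ⟨Γ, {E}⟩ ∧
    E.replaceAt q (Tm.var x') = some E' ∧
    N' = (N \ {(⟨Γ, {E}⟩ : Clause)}) ∪
      {(⟨Γ.map (Atom.subst (singleSubst x x')) + Γ, {E'}⟩ : Clause)}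

/-- Applicability of the Monadic transformation: a non-monadic atom occurs. -/
def MOApp (N : Set Clause) : Prop := ∃ C ∈ N, ∃ A, AtomIn A C ∧ 2 ≤ A.args.length

/-- Applicability of the Horn transformation: a non-Horn clause occurs. -/
def HOApp (N : Set Clause) : Prop := ∃ C ∈ N, 2 ≤ Multiset.card C.pos

/-- Applicability of the Shallow transformation. -/
def SHApp (N : Set Clause) : Prop :=
  ∃ C ∈ N, ∃ E ∈ C.pos, ∃ (p : List ℕ) (s : Tm),
    E.atPos p = some s ∧ Tm.Complex s ∧ 2 ≤ p.length

/-- Applicability of the Linear transformation. -/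
def LIApp (N : Set Clause) : Prop :=
  ∃ C ∈ N, ∃ E ∈ C.pos, ∃ (p q : List ℕ) (x : ℕ),
    p ≠ q ∧ E.atPos p = some (Tm.var x) ∧ E.atPos q = some (Tm.var x)

/-- The approximation relation ⇒_apr: the union of the four transformations,
Monadic preceding Horn preceding Shallow preceding Linear. -/
def Apr (T : ℕ) (fp : ℕ → ℕ) (N N' : Set Clause) : Prop :=
  MOStep T fp N N' ∨
  (¬ MOApp N ∧ HOStep N N') ∨
  (¬ MOApp N ∧ ¬ HOApp N ∧ SHStep N N') ∨
  (¬ MOApp N ∧ ¬ HOApp N ∧ ¬ SHApp N ∧ LIStep N N')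

/-- Reflexive-transitive closure of ⇒_apr. -/
def AprStar (T : ℕ) (fp : ℕ → ℕ) : Set Clause → Set Clause → Prop :=
  Relation.ReflTransGen (Apr T fp)

/-- Freshness of the projection symbols for a clause set: `fp` is injective,
`T` and the symbols `fp P` do not occur in `N`. -/
def FreshFor (T : ℕ) (fp : ℕ → ℕ) (N : Set Clause) : Prop :=
  Function.Injective fp ∧ PredNotIn T N ∧ ∀ P, FnNotIn (fp P) N

/-- Minimal Herbrand model with respect to set inclusion. -/
def MinimalModel (I : Set Atom) (N : Set Clause) : Prop :=
  Models I N ∧ ∀ J : Set Atom, J ⊂ I → ¬ Models J N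

/-- A clause set is monadic if all predicates have at most one argument. -/
def MonadicSet (N : Set Clause) : Prop :=
  ∀ C ∈ N, ∀ A, AtomIn A C → A.args.length ≤ 1

end FOApprox
namespace FOApprox

/-- Entailment of a clause implication: every Herbrand model of `M`
satisfying `C₁` also satisfies `C₂`. -/
def EntailsClauseImp (M : Set Clause) (C₁ C₂ : Clause) : Prop :=
  ∀ I : Set Atom, Models I M → SatClause I C₁ → SatClause I C₂

/-- The set of unit clauses expressing the negation of a clause. -/
def NegClauses (C : Clause) : Set Clause :=
  {D | ∃ A ∈ C.neg, D = ⟨0, {A}⟩} ∪ {D | ∃ A ∈ C.pos, D = ⟨{A}, 0⟩}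

/-- A substitution is a (variable) renaming. -/
def IsRenaming (σ : Subst) : Prop :=
  (∀ x, ∃ y, σ x = Tm.var y) ∧ Function.Injective σ

/-- The clauses of `N` are pairwise variable disjoint. -/
def PairwiseVarDisjoint (N : Set Clause) : Prop :=
  ∀ C ∈ N, ∀ D ∈ N, C ≠ D → ∀ x, VarInClause x C → ¬ VarInClause x D

/-- `R` is a resolvent on an `S`-literal of two clauses from `Nb`. -/
def SResolvent (S : ℕ) (Nb : Set Clause) (R : Clause) : Prop :=
  ∃ D₁ ∈ Nb, ∃ D₂ ∈ Nb, ∃ (A : Atom) (M₁ M₂ : Multiset Atom),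
    A.pred = S ∧ D₁.neg = A ::ₘ M₁ ∧ D₂.pos = A ::ₘ M₂ ∧
    R = ⟨M₁ + D₂.neg, D₁.pos + M₂⟩

/-- The set of ground instances of clauses of `N`. -/
def GroundInstances (N : Set Clause) : Set Clause :=
  {D | (∃ C ∈ N, ∃ σ : Subst, D = Clause.subst σ C) ∧ D.Ground}

/-- `A` is the strictly maximal atom of `D`, occurring positively. -/
def StrictlyMaxIn (altlt : Atom → Atom → Prop) (A : Atom) (D : Clause) : Prop :=
  ∃ M, D.pos = A ::ₘ M ∧ ∀ B ∈ D.neg + M, altlt B A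

/-- The productive atoms δ_D of a ground clause, defined by well-founded
recursion along the ground clause ordering. -/
noncomputable def delta (Ng : Set Clause) (altlt : Atom → Atom → Prop)
    {clt : Clause → Clause → Prop} (wf : WellFounded clt) : Clause → Set Atom :=
  WellFounded.fix (C := fun _ => Set Atom) wf fun D IH =>
    {A | D ∈ Ng ∧ StrictlyMaxIn altlt A D ∧
      ¬ SatClause (⋃ D', ⋃ (h : clt D' D), IH D' h) D}

/-- The superposition partial minimal model operator I_N. -/
noncomputable def partialModel (N : Set Clause) (altlt : Atom → Atom → Prop)
    {clt : Clause → Clause → Prop} (wf : WellFounded clt) : Set Atom :=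
  ⋃ C ∈ GroundInstances N, delta (GroundInstances N) altlt wf C

/-- The hypothesis of the direct Horn lifting lemma for the Horn step
replacing `C₀` (the non-Horn ancestor) by `C₁`, with conflicting core `Nb`. -/
def DirectHornHyp (Nk : Set Clause) (C₀ C₁ : Clause) (Nb : Set Clause) : Prop :=
  ∃ (m : ℕ) (σ σ' τ : Fin m → Subst) (Nsub : Fin m → Set Clause),
    (∀ j, Clause.subst (σ j) C₁ ∈ Nb) ∧
    (∀ D ∈ Nb, (∃ ρ : Subst, D = Clause.subst ρ C₁) →
      ∃ j, D = Clause.subst (σ j) C₁) ∧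
    (∀ j, Nsub j ⊆ Nk) ∧
    (∀ j, EntailsClauseImp (SubstSet (τ j) (Nsub j))
      (Clause.subst (σ' j) C₀) (Clause.subst (σ j) C₁)) ∧
    (∀ j, ConflictingCore (SubstSet (τ j) (Nsub j) ∪
      {Clause.subst (σ' j) C₀} ∪ NegClauses (Clause.subst (σ j) C₁)))

end FOApprox

namespace FOApprox

mutual
theorem Tm.subst_ground {τ : Subst} (hτ : τ.Grounding) : ∀ t : Tm, (t.subst τ).Ground
  | .var x => hτ x
  | .fn f ts => fun ρ => by
    simp only [Tm.subst, Tm.substList_ground hτ ts ρ]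
theorem Tm.substList_ground {τ : Subst} (hτ : τ.Grounding) :
    ∀ (ts : List Tm) (ρ : Subst), Tm.substList ρ (Tm.substList τ ts) = Tm.substList τ ts
  | [], ρ => rfl
  | t :: ts, ρ => by
    simp only [Tm.substList, Tm.substList_ground hτ ts ρ, Tm.subst_ground hτ t ρ]
end

theorem Atom.subst_subst_of_grounding {τ : Subst} (hτ : τ.Grounding) (ρ : Subst) (A : Atom) :
    (A.subst τ).subst ρ = A.subst τ := by
  simp only [Atom.subst, Tm.substList_ground hτ A.args ρ]

/-- The substitution sending the variable `x` to the constant with symbol `K + x`. -/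
def constSubst (K : ℕ) : Subst := fun x => Tm.fn (K + x) []

theorem constSubst_grounding (K : ℕ) : (constSubst K).Grounding := fun _ _ => rfl

mutual
theorem Tm.subst_constSubst_inj {K : ℕ} : ∀ t u : Tm, (∀ f ∈ t.fns, f < K) →
    (∀ f ∈ u.fns, f < K) → t.subst (constSubst K) = u.subst (constSubst K) → t = u
  | .var x, .var y, _, _, h => by
    simpa [Tm.subst, constSubst] using h
  | .var x, .fn g us, _, hu, h => by
    have := hu g (by simp [Tm.fns])
    simp only [Tm.subst, constSubst, Tm.fn.injEq] at h
    omega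
  | .fn f ts, .var y, ht, _, h => by
    have := ht f (by simp [Tm.fns])
    simp only [Tm.subst, constSubst, Tm.fn.injEq] at h
    omega
  | .fn f ts, .fn g us, ht, hu, h => by
    simp only [Tm.subst, Tm.fn.injEq] at h
    rw [h.1, Tm.substList_constSubst_inj ts us (fun k hk => ht k (by simp [Tm.fns, hk]))
      (fun k hk => hu k (by simp [Tm.fns, hk])) h.2]
theorem Tm.substList_constSubst_inj {K : ℕ} : ∀ ts us : List Tm, (∀ f ∈ Tm.fnsList ts, f < K) →
    (∀ f ∈ Tm.fnsList us, f < K) →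
    Tm.substList (constSubst K) ts = Tm.substList (constSubst K) us → ts = us
  | [], [], _, _, _ => rfl
  | [], _ :: _, _, _, h => by simp [Tm.substList] at h
  | _ :: _, [], _, _, h => by simp [Tm.substList] at h
  | t :: ts, u :: us, ht, hu, h => by
    simp only [Tm.substList, List.cons.injEq] at h
    rw [Tm.subst_constSubst_inj t u (fun k hk => ht k (by simp [Tm.fnsList, hk]))
        (fun k hk => hu k (by simp [Tm.fnsList, hk])) h.1,
      Tm.substList_constSubst_inj ts us (fun k hk => ht k (by simp [Tm.fnsList, hk]))
        (fun k hk => hu k (by simp [Tm.fnsList, hk])) h.2]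
end

/-- All function symbols of the atom are smaller than `K`. -/
def Atom.FnsBelow (K : ℕ) (A : Atom) : Prop := ∀ f ∈ Tm.fnsList A.args, f < K

theorem Atom.subst_constSubst_inj {K : ℕ} {A B : Atom} (hA : A.FnsBelow K) (hB : B.FnsBelow K)
    (h : A.subst (constSubst K) = B.subst (constSubst K)) : A = B := by
  obtain ⟨P, as⟩ := A
  obtain ⟨Q, bs⟩ := B
  simp only [Atom.subst, Atom.mk.injEq] at h ⊢
  exact ⟨h.1, Tm.substList_constSubst_inj as bs hA hB h.2⟩

theorem exists_fnsBelow {Nb : Set Clause} (hfin : Nb.Finite) :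
    ∃ K, ∀ C ∈ Nb, ∀ A, AtomIn A C → A.FnsBelow K := by
  have hatoms : {A | ∃ C ∈ Nb, AtomIn A C}.Finite := by
    classical
    refine (hfin.biUnion fun C _ => (C.neg + C.pos).toFinset.finite_toSet).subset ?_
    rintro A ⟨C, hC, hA⟩
    simp only [Set.mem_iUnion]
    exact ⟨C, hC, by simpa [AtomIn] using hA⟩
  have hfns : {f | ∃ A ∈ {A | ∃ C ∈ Nb, AtomIn A C}, f ∈ Tm.fnsList A.args}.Finite := by
    refine (hatoms.biUnion fun A _ => (Tm.fnsList A.args).finite_toSet).subset ?_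
    rintro f ⟨A, hA, hf⟩
    simp only [Set.mem_iUnion]
    exact ⟨A, hA, hf⟩
  obtain ⟨b, hb⟩ := hfns.bddAbove
  exact ⟨b + 1, fun C hC A hA f hf => Nat.lt_succ_of_le (hb ⟨A, ⟨C, hC, hA⟩, hf⟩)⟩

theorem satClause_subst_iff {τ : Subst} (hτ : τ.Grounding) (I : Set Atom) (C : Clause) :
    SatClause I (C.subst τ) ↔
      (∃ A ∈ C.pos, A.subst τ ∈ I) ∨ (∃ A ∈ C.neg, A.subst τ ∉ I) := by
  simp only [SatClause, Clause.subst, Multiset.mem_map, exists_exists_and_eq_and,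
    Atom.subst_subst_of_grounding hτ]
  exact ⟨fun h => h τ hτ, fun h _ _ => h⟩

theorem predInClause_subst_iff (P : ℕ) (ρ : Subst) (C : Clause) :
    PredInClause P (C.subst ρ) ↔ PredInClause P C := by
  simp only [PredInClause, AtomIn, Clause.subst, Multiset.mem_map, or_and_right, exists_or]
  simp [Atom.subst]

theorem Atom.pred_of_replaceAt {A B : Atom} {p : List ℕ} {u : Tm}
    (h : A.replaceAt p u = some B) : B.pred = A.pred := by
  cases p with
  | nil => simp [Atom.replaceAt] at h
  | cons i p =>
    simp only [Atom.replaceAt, Option.bind_eq_some_iff, Option.map_eq_some_iff] at h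
    obtain ⟨_, _, _, _, rfl⟩ := h
    rfl

/-- The interpretation that reads `A.subst (constSubst K)` as `A.subst τ` in `I` for `A` with
predicate other than `S`, and makes an `S`-atom true when a clause of `Nb` derives it. -/
def liftInterp (S K : ℕ) (τ : Subst) (I : Set Atom) (Nb : Set Clause) : Set Atom :=
  {B | ∃ A : Atom, A.FnsBelow K ∧ B = A.subst (constSubst K) ∧
    ((A.pred ≠ S ∧ A.subst τ ∈ I) ∨
      (A.pred = S ∧ ∃ D ∈ Nb, A ∈ D.pos ∧ ∀ G ∈ D.neg, G.subst τ ∈ I))}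

theorem mem_liftInterp_iff {S K : ℕ} {τ : Subst} {I : Set Atom} {Nb : Set Clause} {A : Atom}
    (hA : A.FnsBelow K) : A.subst (constSubst K) ∈ liftInterp S K τ I Nb ↔
      ((A.pred ≠ S ∧ A.subst τ ∈ I) ∨
        (A.pred = S ∧ ∃ D ∈ Nb, A ∈ D.pos ∧ ∀ G ∈ D.neg, G.subst τ ∈ I)) := by
  constructor
  · rintro ⟨B, hB, hAB, h⟩
    rwa [Atom.subst_constSubst_inj hA hB hAB]
  · exact fun h => ⟨A, hA, rfl, h⟩

theorem mem_liftInterp_of_ne {S K : ℕ} {τ : Subst} {I : Set Atom} {Nb : Set Clause} {A : Atom}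
    (hA : A.FnsBelow K) (hne : A.pred ≠ S) :
    A.subst (constSubst K) ∈ liftInterp S K τ I Nb ↔ A.subst τ ∈ I := by
  simp [mem_liftInterp_iff hA, hne]

/-- Lifting the Shallow transformation for conflicting
cores. -/
theorem shallow_core_lifting (N : Set Clause) (Γ₁ Γ₂ : Multiset Atom)
    (E E' : Atom) (p : List ℕ) (s : Tm) (S x : ℕ)
    (hp : E.atPos p = some s) (hs : Tm.Complex s) (hlen : 2 ≤ p.length)
    (hS : PredNotIn S (N ∪ {(⟨Γ₁ + Γ₂, {E}⟩ : Clause)}))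
    (hx : VarNotInClause x ⟨Γ₁ + Γ₂, {E}⟩)
    (hrep : E.replaceAt p (Tm.var x) = some E')
    (Nb : Set Clause)
    (hcore : ConflictingCoreOf Nb (N ∪
      {(⟨(⟨S, [Tm.var x]⟩ : Atom) ::ₘ Γ₁, {E'}⟩ : Clause),
       (⟨Γ₂, {(⟨S, [s]⟩ : Atom)}⟩ : Clause)}))
    (m : ℕ) (σ : Fin m → Subst)
    (hres₁ : ∀ j, SResolvent S Nb (Clause.subst (σ j) (⟨Γ₁ + Γ₂, {E}⟩ : Clause)))
    (hres₂ : ∀ R, SResolvent S Nb R →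
      ∃ j, R = Clause.subst (σ j) (⟨Γ₁ + Γ₂, {E}⟩ : Clause)) :
    ConflictingCoreOf
      ({C ∈ Nb | ¬ PredInClause S C} ∪
        (Set.range fun j => Clause.subst (σ j) (⟨Γ₁ + Γ₂, {E}⟩ : Clause)))
      (N ∪ {(⟨Γ₁ + Γ₂, {E}⟩ : Clause)}) := by
  obtain ⟨⟨hfin, hunsat⟩, hinst⟩ := hcore
  have hΓ : ¬ PredInClause S (⟨Γ₁ + Γ₂, {E}⟩ : Clause) := hS _ (Or.inr rfl)
  have hΓ₁ : ∀ G ∈ Γ₁, G.pred ≠ S := fun G hG h => hΓ ⟨G, Or.inl (by simp [hG]), h⟩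
  have hΓ₂ : ∀ G ∈ Γ₂, G.pred ≠ S := fun G hG h => hΓ ⟨G, Or.inl (by simp [hG]), h⟩
  have hE' : E'.pred ≠ S := fun h =>
    hΓ ⟨E, Or.inr (by simp), (Atom.pred_of_replaceAt hrep).symm.trans h⟩
  have hcases : ∀ C ∈ Nb, ((∃ C' ∈ N, ∃ ρ : Subst, C = C'.subst ρ) ∧ ¬ PredInClause S C) ∨
      (∃ ρ : Subst, C = Clause.subst ρ ⟨⟨S, [Tm.var x]⟩ ::ₘ Γ₁, {E'}⟩) ∨
      (∃ ρ : Subst, C = Clause.subst ρ ⟨Γ₂, {⟨S, [s]⟩}⟩) := by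
    intro C hC
    obtain ⟨C', hC' | rfl | rfl, ρ, rfl⟩ := hinst C hC
    · exact Or.inl ⟨⟨C', hC', ρ, rfl⟩,
        fun h => hS C' (Or.inl hC') ((predInClause_subst_iff S ρ C').1 h)⟩
    · exact Or.inr (Or.inl ⟨ρ, rfl⟩)
    · exact Or.inr (Or.inr ⟨ρ, rfl⟩)
  refine ⟨⟨(hfin.subset (Set.sep_subset _ _)).union (Set.finite_range _), ?_⟩, ?_⟩
  · rintro τ hτ ⟨I, hI⟩
    obtain ⟨K, hK⟩ := exists_fnsBelow hfin
    refine hunsat (constSubst K) (constSubst_grounding K) ⟨liftInterp S K τ I Nb, ?_⟩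
    rintro _ ⟨C, hC, rfl⟩
    rw [satClause_subst_iff (constSubst_grounding K)]
    by_cases hSC : PredInClause S C
    · obtain ⟨_, hn⟩ | ⟨ρ, rfl⟩ | ⟨ρ, rfl⟩ := hcases C hC
      · exact absurd hSC hn
      · by_contra! hfalse
        obtain ⟨hpos, hneg⟩ := hfalse
        set A : Atom := Atom.subst ρ ⟨S, [Tm.var x]⟩ with hA
        have hAC : A ∈ (Clause.subst ρ ⟨⟨S, [Tm.var x]⟩ ::ₘ Γ₁, {E'}⟩).neg := by
          simp [Clause.subst, hA]
        have hAJ := hneg A hAC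
        rw [mem_liftInterp_iff (hK _ hC A (Or.inl hAC))] at hAJ
        obtain ⟨hne, _⟩ | ⟨_, D, hD, hAD, hDneg⟩ := hAJ
        · exact hne rfl
        obtain ⟨_, hn⟩ | ⟨ρ', rfl⟩ | ⟨ρ', rfl⟩ := hcases D hD
        · exact hn ⟨A, Or.inr hAD, rfl⟩
        · simp only [Clause.subst, Multiset.map_singleton, Multiset.mem_singleton] at hAD
          exact hE' (congrArg Atom.pred hAD).symm
        simp only [Clause.subst, Multiset.map_singleton, Multiset.mem_singleton] at hAD
        obtain ⟨j, hj⟩ := hres₂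
          ⟨Γ₁.map (Atom.subst ρ) + Γ₂.map (Atom.subst ρ'), {E'.subst ρ}⟩
          ⟨_, hC, _, hD, A, Γ₁.map (Atom.subst ρ), 0, rfl, by simp [Clause.subst, hA],
            by simp [Clause.subst, hAD], by simp [Clause.subst]⟩
        have hsat := hI _ ⟨_, Or.inr ⟨j, rfl⟩, rfl⟩
        dsimp only at hsat
        rw [← hj, satClause_subst_iff hτ] at hsat
        obtain ⟨B, hB, hBI⟩ | ⟨B, hB, hBI⟩ := hsat
        · obtain rfl : B = E'.subst ρ := by simpa using hB
          have hBC : E'.subst ρ ∈ (Clause.subst ρ ⟨⟨S, [Tm.var x]⟩ ::ₘ Γ₁, {E'}⟩).pos := by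
            simp [Clause.subst]
          exact hpos _ hBC ((mem_liftInterp_of_ne (hK _ hC _ (Or.inr hBC)) hE').2 hBI)
        · obtain hB | hB := Multiset.mem_add.1 hB
          · have hBC : B ∈ (Clause.subst ρ ⟨⟨S, [Tm.var x]⟩ ::ₘ Γ₁, {E'}⟩).neg := by
              simpa [Clause.subst] using Or.inr (Multiset.mem_map.1 hB)
            obtain ⟨G, hG, rfl⟩ := Multiset.mem_map.1 hB
            exact hBI ((mem_liftInterp_of_ne (hK _ hC _ (Or.inl hBC)) (hΓ₁ G hG)).1
              (hneg _ hBC))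
          · exact hBI (hDneg B hB)
      · by_contra! hfalse
        obtain ⟨hpos, hneg⟩ := hfalse
        have hAC : Atom.subst ρ ⟨S, [s]⟩ ∈ (Clause.subst ρ ⟨Γ₂, {⟨S, [s]⟩}⟩).pos := by
          simp [Clause.subst]
        refine hpos _ hAC ((mem_liftInterp_iff (hK _ hC _ (Or.inr hAC))).2
          (Or.inr ⟨rfl, _, hC, hAC, fun B hB => ?_⟩))
        have hBJ := hneg B hB
        obtain ⟨G, hG, rfl⟩ := Multiset.mem_map.1 hB
        exact (mem_liftInterp_of_ne (hK _ hC _ (Or.inl hB)) (hΓ₂ G hG)).1 hBJ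
    · have hsat := hI _ ⟨C, Or.inl ⟨hC, hSC⟩, rfl⟩
      rw [satClause_subst_iff hτ] at hsat
      have hne : ∀ A, AtomIn A C → A.pred ≠ S := fun A hA h => hSC ⟨A, hA, h⟩
      refine hsat.imp ?_ ?_
      · rintro ⟨A, hA, hAI⟩
        exact ⟨A, hA, (mem_liftInterp_of_ne (hK C hC A (Or.inr hA)) (hne A (Or.inr hA))).2 hAI⟩
      · rintro ⟨A, hA, hAI⟩
        exact ⟨A, hA, fun h => hAI
          ((mem_liftInterp_of_ne (hK C hC A (Or.inl hA)) (hne A (Or.inl hA))).1 h)⟩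
  · rintro C (⟨hC, hSC⟩ | ⟨j, rfl⟩)
    · obtain ⟨⟨C', hC', ρ, rfl⟩, _⟩ | ⟨ρ, rfl⟩ | ⟨ρ, rfl⟩ := hcases C hC
      · exact ⟨C', Or.inl hC', ρ, rfl⟩
      · exact absurd ((predInClause_subst_iff S ρ _).2
          ⟨⟨S, [Tm.var x]⟩, Or.inl (by simp), rfl⟩) hSC
      · exact absurd ((predInClause_subst_iff S ρ _).2 ⟨⟨S, [s]⟩, Or.inr (by simp), rfl⟩) hSC
    · exact ⟨_, Or.inr rfl, σ j, rfl⟩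

end FOApprox
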